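/- arXiv:0902.4806 — 2 statements merged into one kernel-verified Lean document; each statement's English description precedes it below -/
import Mathlib

section
/- Let σ > 0, A > 0, c₁, c₂ real, and let ν satisfy 0 < ν < 1. For all t > 0, x > 0, and λ ≥ 0, the following integral identity holds: ∫_0^∞ e^{−λ y} · (√x/(σ t)) e^{ −(x+y)/(σ t) − At/(2σ) } [ c₁ I_ν( 2√(xy)/(σ t) ) I_ν( √(2Ay)/σ ) + c₂ I_{−ν}( 2√(xy)/(σ t) ) I_{−ν}( √(2Ay)/σ ) ] dy = ( √x / (1 + λσt) ) exp( −λ(x + At²/2)/(1 + λσt) ) [ c₁ I_ν( √(2Ax)/(σ(1+λσt)) ) + c₂ I_{−ν}( √(2Ax)/(σ(1+λσt)) ) ]. -/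
open Real MeasureTheory

/-- The modified Bessel function of the first kind,
`I_ν(z) = ∑_{k=0}^∞ (z/2)^{2k+ν} / (k! Γ(k+ν+1))`. -/
noncomputable def besselI (ν z : ℝ) : ℝ :=
  ∑' k : ℕ, (z / 2) ^ (2 * (k : ℝ) + ν) / ((Nat.factorial k : ℝ) * Real.Gamma ((k : ℝ) + ν + 1))


/-- Chu–Vandermonde summation for reciprocal Gamma values. -/
lemma sum_choose_mul_descFactorial_div_Gamma (j : ℕ) : ∀ (k : ℕ) (μ : ℝ), -1 < μ →
    ∑ m ∈ Finset.range (j + 1), (j.choose m : ℝ) * (k.descFactorial m / Gamma (m + μ + 1))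
      = Gamma (j + k + μ + 1) / (Gamma (j + μ + 1) * Gamma (k + μ + 1)) := by
  induction j with
  | zero =>
    intro k μ hμ
    have h1 : Gamma (k + μ + 1) ≠ 0 :=
      (Gamma_pos_of_pos (by have := k.cast_nonneg (α := ℝ); linarith)).ne'
    have h2 : Gamma (μ + 1) ≠ 0 := (Gamma_pos_of_pos (by linarith)).ne'
    simp
    field_simp
  | succ j ih =>
    intro k μ hμ
    have pascal (f : ℕ → ℝ) :
        ∑ m ∈ Finset.range (j + 1 + 1), ((j + 1).choose m : ℝ) * f m
          = ∑ m ∈ Finset.range (j + 1), (j.choose m : ℝ) * f m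
            + ∑ m ∈ Finset.range (j + 1), (j.choose m : ℝ) * f (m + 1) := by
      have h : ∑ m ∈ Finset.range (j + 1), (j.choose m : ℝ) * f m
          = ∑ m ∈ Finset.range (j + 1 + 1), (j.choose m : ℝ) * f m := by
        simp [Finset.sum_range_succ _ (j + 1)]
      rw [h, Finset.sum_range_succ' _ (j + 1), Finset.sum_range_succ' _ (j + 1)]
      simp only [Nat.choose_succ_succ', Nat.cast_add, add_mul, Finset.sum_add_distrib,
        Nat.choose_zero_right]
      ring
    have hj := j.cast_nonneg (α := ℝ)
    have hk := k.cast_nonneg (α := ℝ)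
    have hgj : Gamma (j + μ + 1) ≠ 0 := (Gamma_pos_of_pos (by linarith)).ne'
    have hgk : Gamma (k + μ + 1) ≠ 0 := (Gamma_pos_of_pos (by linarith)).ne'
    have hj1 : (j : ℝ) + μ + 1 ≠ 0 := by linarith
    have rj : Gamma ((j + 1 : ℕ) + μ + 1) = (j + μ + 1) * Gamma (j + μ + 1) := by
      rw [← Gamma_add_one hj1]; push_cast; ring_nf
    have rjk : Gamma ((j + 1 : ℕ) + k + μ + 1) = (j + k + μ + 1) * Gamma (j + k + μ + 1) := by
      rw [← Gamma_add_one (by linarith)]; push_cast; ring_nf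
    rw [pascal, ih k μ hμ, rj, rjk]
    cases k with
    | zero =>
      simp only [Nat.zero_descFactorial_succ]
      field_simp
      simp
    | succ k =>
      have hshift : ∑ m ∈ Finset.range (j + 1), (j.choose m : ℝ) *
          ((k + 1).descFactorial (m + 1) / Gamma ((m + 1 : ℕ) + μ + 1))
          = (k + 1) * (Gamma (j + k + (μ + 1) + 1)
            / (Gamma (j + (μ + 1) + 1) * Gamma (k + (μ + 1) + 1))) := by
        rw [← ih k (μ + 1) (by linarith), Finset.mul_sum]
        refine Finset.sum_congr rfl fun m _ ↦ ?_
        rw [Nat.succ_descFactorial_succ]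
        push_cast
        rw [show (m : ℝ) + 1 + μ + 1 = m + (μ + 1) + 1 by ring]
        ring
      rw [hshift]
      rw [show (j : ℝ) + (μ + 1) + 1 = (j + 1 : ℕ) + μ + 1 by push_cast; ring, rj,
        show (k : ℝ) + (μ + 1) + 1 = (k + 1 : ℕ) + μ + 1 by push_cast; ring,
        show (j : ℝ) + k + (μ + 1) + 1 = j + (k + 1 : ℕ) + μ + 1 by push_cast; ring]
      field_simp
      push_cast
      ring

lemma factorial_mul_Gamma_pos {μ : ℝ} (hμ : -1 < μ) (k : ℕ) :
    0 < (k.factorial : ℝ) * Gamma (k + μ + 1) :=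
  mul_pos (by positivity) (Gamma_pos_of_pos (by have := k.cast_nonneg (α := ℝ); linarith))

lemma summable_pow_div_factorial_mul_Gamma {μ : ℝ} (hμ : -1 < μ) (z : ℝ) :
    Summable fun k : ℕ ↦ z ^ k / (k.factorial * Gamma (k + μ + 1)) := by
  refine (summable_pow_div_factorial |z|).of_norm_bounded_eventually_nat ?_
  filter_upwards [Filter.eventually_ge_atTop 2] with k hk
  have hk' : (2 : ℝ) ≤ k := by exact_mod_cast hk
  have hG : 1 ≤ Gamma (k + μ + 1) := by
    have h2 : 2 ≤ k + μ + 1 := by linarith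
    simpa using Gamma_strictMonoOn_Ici.monotoneOn (Set.mem_Ici.2 le_rfl) (Set.mem_Ici.2 h2) h2
  have hf : (0 : ℝ) < k.factorial := by positivity
  rw [norm_div, norm_pow, norm_eq_abs, norm_eq_abs,
    abs_of_pos (factorial_mul_Gamma_pos hμ k)]
  gcongr
  nlinarith

lemma besselI_eq_rpow_mul_tsum {z : ℝ} (hz : 0 < z) (μ : ℝ) :
    besselI μ z = (z / 2) ^ μ * ∑' k : ℕ, ((z / 2) ^ 2) ^ k / (k.factorial * Gamma (k + μ + 1)) := by
  rw [besselI, ← tsum_mul_left]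
  refine tsum_congr fun k ↦ ?_
  rw [rpow_add (by positivity), rpow_mul (by positivity)]
  norm_num
  ring

lemma besselI_pos {μ z : ℝ} (hμ : -1 < μ) (hz : 0 < z) : 0 < besselI μ z := by
  rw [besselI_eq_rpow_mul_tsum hz]
  have hterm (k : ℕ) : 0 < ((z / 2) ^ 2) ^ k / (k.factorial * Gamma (k + μ + 1)) :=
    div_pos (by positivity) (factorial_mul_Gamma_pos hμ k)
  exact mul_pos (by positivity) ((summable_pow_div_factorial_mul_Gamma hμ _).tsum_pos
    (fun k ↦ (hterm k).le) 0 (hterm 0))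

/-- The double series obtained by integrating a product of two Bessel series term by term. -/
lemma hasSum_pow_mul_pow_mul_Gamma {μ α β : ℝ} (hμ : -1 < μ) (hα : 0 ≤ α) (hβ : 0 ≤ β) :
    HasSum (fun n : ℕ × ℕ ↦ α ^ n.1 / (n.1.factorial * Gamma (n.1 + μ + 1)) *
        (β ^ n.2 / (n.2.factorial * Gamma (n.2 + μ + 1))) * Gamma (n.1 + n.2 + μ + 1))
      (exp (α + β) * ∑' m : ℕ, (α * β) ^ m / (m.factorial * Gamma (m + μ + 1))) := by
  have hexp (z : ℝ) : HasSum (fun k : ℕ ↦ z ^ k / k.factorial) (exp z) := by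
    simpa [exp_eq_exp_ℝ] using NormedSpace.expSeries_div_hasSum_exp z
  have hbessel := (summable_pow_div_factorial_mul_Gamma hμ (α * β)).hasSum
  have hpq := (hexp α).mul (hexp β) ((hexp α).summable.mul_of_nonneg (hexp β).summable
    (fun k ↦ by positivity) (fun k ↦ by positivity))
  have hmpq := hpq.mul hbessel (hpq.summable.mul_of_nonneg hbessel.summable
    (fun n ↦ mul_nonneg (by positivity) (by positivity))
    (fun k ↦ div_nonneg (by positivity) (factorial_mul_Gamma_pos hμ k).le))
  rw [← exp_add] at hmpq
  let shift : (ℕ × ℕ) × ℕ → (ℕ × ℕ) × ℕ := fun n ↦ ((n.2 + n.1.1, n.2 + n.1.2), n.2)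
  let summand : (ℕ × ℕ) × ℕ → ℝ := fun n ↦
    α ^ n.1.1 / n.1.1.factorial * (β ^ n.1.2 / n.1.2.factorial) *
    ((n.1.1.choose n.2 : ℝ) * (n.1.2.descFactorial n.2 / Gamma (n.2 + μ + 1)))
  have hinj : Function.Injective shift := by
    rintro ⟨⟨p, q⟩, m⟩ ⟨⟨r, s⟩, l⟩ h
    simp only [shift, Prod.mk.injEq] at h ⊢
    omega
  have hzero : ∀ n ∉ Set.range shift, summand n = 0 := by
    rintro ⟨⟨j, k⟩, m⟩ hn
    rcases lt_or_ge j m with hj | hj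
    · simp [summand, Nat.choose_eq_zero_of_lt hj]
    rcases lt_or_ge k m with hk | hk
    · simp [summand, Nat.descFactorial_of_lt hk]
    · exact absurd ⟨((j - m, k - m), m), by simp [shift, hj, hk]⟩ hn
  have hcomp : HasSum (summand ∘ shift)
      (exp (α + β) * ∑' m : ℕ, (α * β) ^ m / (m.factorial * Gamma (m + μ + 1))) := by
    refine (congrArg (HasSum · _) (funext ?_)).mpr hmpq
    rintro ⟨⟨p, q⟩, m⟩
    have hG : Gamma (m + μ + 1) ≠ 0 := right_ne_zero_of_mul (factorial_mul_Gamma_pos hμ m).ne'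
    have hc : (((m + p).choose m : ℕ) : ℝ) * m.factorial * p.factorial = (m + p).factorial := by
      rw [Nat.choose_symm_add]
      exact_mod_cast Nat.add_choose_mul_factorial_mul_factorial m p
    have hd : (q.factorial : ℝ) * (m + q).descFactorial m = (m + q).factorial := by
      have := Nat.factorial_mul_descFactorial (Nat.le_add_right m q)
      rw [Nat.add_sub_cancel_left] at this
      exact_mod_cast this
    have hc0 : (((m + p).choose m : ℕ) : ℝ) ≠ 0 :=
      Nat.cast_ne_zero.2 (Nat.choose_pos (Nat.le_add_right m p)).ne'
    have hd0 : ((m + q).descFactorial m : ℝ) ≠ 0 :=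
      Nat.cast_ne_zero.2 (Nat.descFactorial_pos.2 (Nat.le_add_right m q)).ne'
    simp only [summand, shift, Function.comp_apply, ← hc, ← hd]
    field_simp
    ring
  refine ((hinj.hasSum_iff hzero).1 hcomp).prod_fiberwise fun ⟨j, k⟩ ↦ ?_
  have hfin : HasSum (fun m ↦ summand ((j, k), m)) (∑ m ∈ Finset.range (j + 1), summand ((j, k), m)) :=
    hasSum_sum_of_ne_finset_zero fun m hm ↦ by
      simp [summand, Nat.choose_eq_zero_of_lt (show j < m by simpa using hm)]
  convert hfin using 1
  simp only [summand, ← Finset.mul_sum, sum_choose_mul_descFactorial_div_Gamma j k μ hμ]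
  ring

/-- The Weber integral of the product of two modified Bessel functions. -/
lemma integral_exp_mul_besselI_mul_besselI {μ a b p : ℝ} (hμ : -1 < μ) (ha : 0 < a) (hb : 0 < b)
    (hp : 0 < p) :
    ∫ y in Set.Ioi (0 : ℝ), exp (-(p * y)) * (besselI μ (2 * a * √y) * besselI μ (2 * b * √y))
      = 1 / p * exp ((a ^ 2 + b ^ 2) / p) * besselI μ (2 * a * b / p) := by
  let c : ℕ → ℝ := fun k ↦ k.factorial * Gamma (k + μ + 1)
  have hc (k : ℕ) : 0 < c k := factorial_mul_Gamma_pos hμ k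
  let F : ℕ × ℕ → ℝ → ℝ := fun n y ↦
    ((a * b) ^ μ * ((a ^ 2) ^ n.1 / c n.1 * ((b ^ 2) ^ n.2 / c n.2))) *
    (y ^ ((n.1 + n.2 + μ + 1 : ℝ) - 1) * exp (-(p * y)))
  have hpos (n : ℕ × ℕ) : 0 < (n.1 + n.2 + μ + 1 : ℝ) := by
    have h1 := n.1.cast_nonneg (α := ℝ)
    have h2 := n.2.cast_nonneg (α := ℝ)
    linarith
  have hF_int (n : ℕ × ℕ) : ∫ y in Set.Ioi (0 : ℝ), F n y
      = 1 / p * (a * b / p) ^ μ * ((a ^ 2 / p) ^ n.1 / c n.1 * ((b ^ 2 / p) ^ n.2 / c n.2) *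
        Gamma (n.1 + n.2 + μ + 1)) := by
    simp only [F]
    rw [integral_const_mul, integral_rpow_mul_exp_neg_mul_Ioi (hpos n) hp,
      div_rpow one_pos.le hp.le, div_rpow (by positivity) hp.le, one_rpow, rpow_add hp, rpow_add hp,
      rpow_add hp, rpow_natCast, rpow_natCast, rpow_one, div_pow, div_pow]
    field_simp
  have hF_pos (n : ℕ × ℕ) : 0 < ∫ y in Set.Ioi (0 : ℝ), F n y := by
    rw [hF_int]
    have := hc n.1
    have := hc n.2
    have := Gamma_pos_of_pos (hpos n)
    positivity
  have hF_integrable (n : ℕ × ℕ) : Integrable (F n) (volume.restrict (Set.Ioi 0)) :=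
    .of_integral_ne_zero (hF_pos n).ne'
  have hF_norm (n : ℕ × ℕ) : ∫ y in Set.Ioi (0 : ℝ), ‖F n y‖ = ∫ y in Set.Ioi (0 : ℝ), F n y := by
    refine setIntegral_congr_fun measurableSet_Ioi fun y (hy : 0 < y) ↦ ?_
    have := hc n.1
    have := hc n.2
    exact norm_of_nonneg (by simp only [F]; positivity)
  have hsum := (hasSum_pow_mul_pow_mul_Gamma hμ (α := a ^ 2 / p) (β := b ^ 2 / p)
    (by positivity) (by positivity)).mul_left (1 / p * (a * b / p) ^ μ)
  have hswap := hasSum_integral_of_summable_integral_norm hF_integrable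
    (by simpa only [hF_norm, hF_int] using hsum.summable)
  simp only [hF_int] at hswap
  have heq : ∀ y ∈ Set.Ioi (0 : ℝ), exp (-(p * y)) *
      (besselI μ (2 * a * √y) * besselI μ (2 * b * √y)) = ∑' n, F n y := by
    intro y (hy : 0 < y)
    have hseries (d : ℝ) (hd : 0 < d) : besselI μ (2 * d * √y)
        = (d * √y) ^ μ * ∑' k : ℕ, (d ^ 2 * y) ^ k / c k := by
      rw [besselI_eq_rpow_mul_tsum (by positivity), show 2 * d * √y / 2 = d * √y by ring,
        mul_pow, sq_sqrt hy.le]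
    have hs (d : ℝ) : Summable fun k : ℕ ↦ (d ^ 2 * y) ^ k / c k :=
      summable_pow_div_factorial_mul_Gamma hμ _
    have hprod := (hs a).tsum_mul_tsum (hs b) ((hs a).mul_of_nonneg (hs b)
      (fun k ↦ div_nonneg (by positivity) (hc k).le) (fun k ↦ div_nonneg (by positivity) (hc k).le))
    rw [hseries a ha, hseries b hb, mul_mul_mul_comm, hprod, ← mul_assoc, ← tsum_mul_left]
    refine tsum_congr fun n ↦ ?_
    simp only [F]
    rw [← mul_rpow (by positivity) (by positivity), mul_mul_mul_comm a, mul_self_sqrt hy.le,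
      mul_rpow (by positivity) hy.le, add_sub_cancel_right, rpow_add hy, rpow_add hy,
      rpow_natCast, rpow_natCast, mul_pow, mul_pow]
    ring
  rw [setIntegral_congr_fun measurableSet_Ioi heq, hswap.unique hsum,
    besselI_eq_rpow_mul_tsum (by positivity), show 2 * a * b / p / 2 = a * b / p by ring,
    show a ^ 2 / p * (b ^ 2 / p) = (a * b / p) ^ 2 by ring, ← add_div]
  ring

lemma integrableOn_exp_mul_besselI_mul_besselI {μ a b p : ℝ} (hμ : -1 < μ) (ha : 0 < a)
    (hb : 0 < b) (hp : 0 < p) :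
    IntegrableOn (fun y ↦ exp (-(p * y)) * (besselI μ (2 * a * √y) * besselI μ (2 * b * √y)))
      (Set.Ioi 0) := by
  have hI := besselI_pos hμ (show 0 < 2 * a * b / p by positivity)
  refine .of_integral_ne_zero ?_
  rw [integral_exp_mul_besselI_mul_besselI hμ ha hb hp]
  positivity

/-- The key Laplace transform identity (4.11) in the proof of Theorem 4.2. -/
theorem stmt_13 (σ A c₁ c₂ ν t x lam : ℝ) (hσ : 0 < σ) (hA : 0 < A)
    (hν : 0 < ν) (hν1 : ν < 1)
    (ht : 0 < t) (hx : 0 < x) (hlam : 0 ≤ lam) :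
    (∫ y in Set.Ioi (0 : ℝ),
      Real.exp (-lam * y) * ((Real.sqrt x / (σ * t))
        * Real.exp (-(x + y) / (σ * t) - A * t / (2 * σ))
        * (c₁ * besselI ν (2 * Real.sqrt (x * y) / (σ * t))
              * besselI ν (Real.sqrt (2 * A * y) / σ)
          + c₂ * besselI (-ν) (2 * Real.sqrt (x * y) / (σ * t))
              * besselI (-ν) (Real.sqrt (2 * A * y) / σ))))
    = (Real.sqrt x / (1 + lam * σ * t))
        * Real.exp (-lam * (x + A * t ^ 2 / 2) / (1 + lam * σ * t))
        * (c₁ * besselI ν (Real.sqrt (2 * A * x) / (σ * (1 + lam * σ * t)))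
          + c₂ * besselI (-ν) (Real.sqrt (2 * A * x) / (σ * (1 + lam * σ * t)))) := by
  have hst : 0 < σ * t := by positivity
  have hL : 0 < 1 + lam * σ * t := by positivity
  set a := √x / (σ * t) with ha_def
  set b := √(2 * A) / (2 * σ) with hb_def
  set p := (1 + lam * σ * t) / (σ * t) with hp_def
  have ha : 0 < a := by positivity
  have hb : 0 < b := by positivity
  have hp : 0 < p := by positivity
  have hintegrable {μ : ℝ} (hμ : -1 < μ) :=
    integrableOn_exp_mul_besselI_mul_besselI hμ ha hb hp
  have hμ : -1 < ν := by linarith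
  have hμ' : -1 < -ν := by linarith
  set K := a * exp (-x / (σ * t) - A * t / (2 * σ)) with hK_def
  have hy : ∀ y ∈ Set.Ioi (0 : ℝ),
      exp (-lam * y) * (a * exp (-(x + y) / (σ * t) - A * t / (2 * σ))
        * (c₁ * besselI ν (2 * √(x * y) / (σ * t)) * besselI ν (√(2 * A * y) / σ)
          + c₂ * besselI (-ν) (2 * √(x * y) / (σ * t)) * besselI (-ν) (√(2 * A * y) / σ)))
      = K * c₁ * (exp (-(p * y)) * (besselI ν (2 * a * √y) * besselI ν (2 * b * √y)))
        + K * c₂ * (exp (-(p * y)) * (besselI (-ν) (2 * a * √y) * besselI (-ν) (2 * b * √y))) := by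
    intro y _
    have h1 : 2 * √(x * y) / (σ * t) = 2 * a * √y := by
      rw [sqrt_mul hx.le, ha_def]; ring
    have h2 : √(2 * A * y) / σ = 2 * b * √y := by
      rw [sqrt_mul (by positivity), hb_def]; field_simp
    have h3 : exp (-lam * y) * exp (-(x + y) / (σ * t) - A * t / (2 * σ))
        = exp (-x / (σ * t) - A * t / (2 * σ)) * exp (-(p * y)) := by
      rw [← exp_add, ← exp_add, hp_def]
      congr 1
      field_simp
      ring
    rw [h1, h2, hK_def]
    linear_combination (a * (c₁ * besselI ν (2 * a * √y) * besselI ν (2 * b * √y)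
      + c₂ * besselI (-ν) (2 * a * √y) * besselI (-ν) (2 * b * √y))) * h3
  have harg : 2 * a * b / p = √(2 * A * x) / (σ * (1 + lam * σ * t)) := by
    rw [sqrt_mul (by positivity), ha_def, hb_def, hp_def]
    field_simp
  have hexp : exp (-x / (σ * t) - A * t / (2 * σ)) * exp ((a ^ 2 + b ^ 2) / p)
      = exp (-lam * (x + A * t ^ 2 / 2) / (1 + lam * σ * t)) := by
    rw [← exp_add, ha_def, hb_def, hp_def, div_pow, div_pow, sq_sqrt hx.le,
      sq_sqrt (by positivity)]
    congr 1
    field_simp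
    ring
  have hap : a / p = √x / (1 + lam * σ * t) := by
    rw [ha_def, hp_def]
    field_simp
  rw [setIntegral_congr_fun measurableSet_Ioi hy,
    integral_add ((hintegrable hμ).const_mul _) ((hintegrable hμ').const_mul _), integral_const_mul,
    integral_const_mul, integral_exp_mul_besselI_mul_besselI hμ ha hb hp,
    integral_exp_mul_besselI_mul_besselI hμ' ha hb hp, harg, ← hexp, ← hap, hK_def]
  ring
end

section
/- Let σ > 0, μ ≥ 0, A > 0, and B, C be real with 1 + 2C/σ² > 0, and set β = (1/2)√(1 + 2C/σ²); assume β is not an integer. Let f : (0,∞) → ℝ be differentiable and satisfy the Riccati equation σ f'(x) + (1/2) f(x)² = C/x² + B/2 + (1/8)(A − 16μσ) x² for all x > 0, and let F : (0,∞) → ℝ be differentiable with F'(x) = f(x). Fix y > 0 and real constants C₁, C₂, and define for t > 0, x > 0: p(t,x,y) = ( √(Axy) / (2 sinh(√A t/2)) ) exp( −Bt/(4σ) + (F(y) − F(x))/(2σ) − √A (x² + y²)/(8σ tanh(√A t/2)) ) · ( C₁ I_β( √A x y/(4σ sinh(√A t/2)) ) + C₂ I_{−β}( √A x y/(4σ sinh(√A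 t/2)) ) ). Then for all t > 0 and x > 0, ∂_t p = σ ∂²_x p + f(x) ∂_x p − μ x² p. -/
open Real MeasureTheory

/-- The coefficients of the entire function `w ↦ ∑ w ^ k / (k! Γ(k + ν + 1))`. -/
noncomputable def besselCoeff (ν : ℝ) (k : ℕ) : ℝ :=
  ((Nat.factorial k : ℝ) * Real.Gamma ((k : ℝ) + ν + 1))⁻¹

/-- The entire function `w ↦ ∑ w ^ k / (k! Γ(k + ν + 1))`, the regular factor of `besselI ν`. -/
noncomputable def besselEntire (ν w : ℝ) : ℝ :=
  ∑' k : ℕ, besselCoeff ν k * w ^ k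

theorem inv_Gamma_eq_mul_inv_Gamma_add_one (s : ℝ) :
    (Real.Gamma s)⁻¹ = s * (Real.Gamma (s + 1))⁻¹ := by
  rcases eq_or_ne s 0 with rfl | hs
  · simp [Real.Gamma_zero]
  · rw [Real.Gamma_add_one hs, mul_inv, mul_inv_cancel_left₀ hs]

theorem besselCoeff_succ (ν : ℝ) (k : ℕ) :
    ((k : ℝ) + 1) * besselCoeff ν (k + 1) = besselCoeff (ν + 1) k := by
  have hk : ((k : ℝ) + 1) ≠ 0 := by positivity
  have h : (k : ℝ) + 1 + ν + 1 = k + (ν + 1) + 1 := by ring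
  unfold besselCoeff
  rw [Nat.factorial_succ]
  push_cast
  rw [h, mul_assoc, mul_inv, mul_inv_cancel_left₀ hk]

theorem besselCoeff_eq_mul_add_one (ν : ℝ) (k : ℕ) :
    besselCoeff ν k = ((k : ℝ) + ν + 1) * besselCoeff (ν + 1) k := by
  unfold besselCoeff
  have h : (k : ℝ) + (ν + 1) + 1 = k + ν + 1 + 1 := by ring
  rw [mul_inv, mul_inv, inv_Gamma_eq_mul_inv_Gamma_add_one, h]
  ring

theorem summable_besselCoeff (ν w : ℝ) : Summable fun k => besselCoeff ν k * w ^ k := by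
  refine summable_of_ratio_norm_eventually_le (r := 1 / 2) (by norm_num) ?_
  filter_upwards [Filter.eventually_ge_atTop ⌈2 * |w| + |ν|⌉₊] with k hk
  have hk' : 2 * |w| + |ν| ≤ k := Nat.ceil_le.mp hk
  have hν := neg_abs_le ν
  have hw := abs_nonneg w
  have h1 : besselCoeff ν k = ((k : ℝ) + ν + 1) * (((k : ℝ) + 1) * besselCoeff ν (k + 1)) := by
    rw [besselCoeff_succ, ← besselCoeff_eq_mul_add_one]
  rw [h1]
  simp only [norm_mul, Real.norm_eq_abs, pow_succ]
  rw [abs_of_nonneg (by linarith : 0 ≤ (k : ℝ) + ν + 1), abs_of_nonneg (by positivity : 0 ≤ (k : ℝ) + 1)]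
  have h2 : |w| ≤ 1 / 2 * (((k : ℝ) + ν + 1) * ((k : ℝ) + 1)) := by
    nlinarith [abs_nonneg ν, (Nat.cast_nonneg k : (0 : ℝ) ≤ k)]
  have h3 : 0 ≤ |besselCoeff ν (k + 1)| * |w ^ k| := by positivity
  nlinarith [mul_le_mul_of_nonneg_left h2 h3]

theorem hasDerivAt_besselEntire (ν w : ℝ) :
    HasDerivAt (besselEntire ν) (besselEntire (ν + 1) w) w := by
  have hterm : ∀ (k : ℕ) (v : ℝ), HasDerivAt (fun v => besselCoeff ν k * v ^ k)
      (besselCoeff ν k * (k * v ^ (k - 1))) v := fun k v => (hasDerivAt_pow k v).const_mul _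
  have hsucc : ∀ (v : ℝ) (k : ℕ), besselCoeff ν (k + 1) * (((k + 1 : ℕ) : ℝ) * v ^ (k + 1 - 1))
      = besselCoeff (ν + 1) k * v ^ k := by
    intro v k
    rw [← besselCoeff_succ]
    push_cast
    ring
  have hsum : ∀ v : ℝ, Summable fun k : ℕ => besselCoeff ν k * (k * v ^ (k - 1)) := by
    intro v
    rw [← summable_nat_add_iff 1]
    simp only [hsucc]
    exact summable_besselCoeff _ _
  have key := hasDerivAt_tsum_of_isPreconnected (hsum (|w| + 1)).norm
    (Metric.isOpen_ball (x := (0 : ℝ)) (ε := |w| + 1))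
    (convex_ball (0 : ℝ) (|w| + 1)).isPreconnected (fun k v _ => hterm k v) ?_
    (Metric.mem_ball_self (by positivity)) (summable_besselCoeff ν 0)
    (show w ∈ Metric.ball (0 : ℝ) (|w| + 1) by simp)
  · rw [(hsum w).tsum_eq_zero_add] at key
    simp only [hsucc] at key
    refine key.congr_deriv ?_
    simp [besselEntire]
  · intro k v hv
    have hv' : |v| < |w| + 1 := by simpa using hv
    simp only [norm_mul, norm_pow, Real.norm_eq_abs]
    have h0 : |(|w| + 1)| = |w| + 1 := abs_of_nonneg (by positivity)
    rw [h0]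
    gcongr

theorem besselEntire_recurrence (ν w : ℝ) :
    w * besselEntire (ν + 1 + 1) w + (ν + 1) * besselEntire (ν + 1) w = besselEntire ν w := by
  have h2 := summable_besselCoeff (ν + 1 + 1) w
  have h1 := summable_besselCoeff (ν + 1) w
  have hterm : ∀ k : ℕ, besselCoeff (ν + 1) (k + 1) * ((k + 1 : ℕ) : ℝ) * w ^ (k + 1)
      = w * (besselCoeff (ν + 1 + 1) k * w ^ k) := by
    intro k
    rw [← besselCoeff_succ (ν + 1)]
    push_cast
    ring
  have hs : Summable fun k : ℕ => besselCoeff (ν + 1) k * (k : ℝ) * w ^ k := by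
    rw [← summable_nat_add_iff 1]
    simp only [hterm]
    exact h2.mul_left w
  have hshift : ∑' k : ℕ, besselCoeff (ν + 1) k * (k : ℝ) * w ^ k
      = w * besselEntire (ν + 1 + 1) w := by
    rw [hs.tsum_eq_zero_add]
    simp only [hterm]
    simp [besselEntire, tsum_mul_left]
  rw [← hshift]
  unfold besselEntire
  rw [← tsum_mul_left, ← hs.tsum_add (h1.mul_left _)]
  refine tsum_congr fun k => ?_
  rw [besselCoeff_eq_mul_add_one ν]
  ring

theorem besselI_eq (ν : ℝ) {z : ℝ} (hz : 0 < z) :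
    besselI ν z = (z / 2) ^ ν * besselEntire ν ((z / 2) ^ 2) := by
  unfold besselI besselEntire
  rw [← tsum_mul_left]
  refine tsum_congr fun k => ?_
  have h : (z / 2) ^ (2 * (k : ℝ)) = ((z / 2) ^ 2) ^ k := by
    rw [← pow_mul, ← Real.rpow_natCast]
    push_cast
    rfl
  rw [Real.rpow_add (by positivity), h, besselCoeff]
  ring

/-- `D₁` and `D₂` are the first two derivatives of `J` on the positive half-line, and `J` solves
the modified Bessel equation of order `ν` there. -/
structure IsModifiedBesselSolution (ν : ℝ) (J D₁ D₂ : ℝ → ℝ) : Prop where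
  hasDerivAt : ∀ z > 0, HasDerivAt J (D₁ z) z
  hasDerivAt_deriv : ∀ z > 0, HasDerivAt D₁ (D₂ z) z
  equation : ∀ z > 0, z ^ 2 * D₂ z + z * D₁ z = (z ^ 2 + ν ^ 2) * J z

theorem exists_isModifiedBesselSolution_besselI (ν : ℝ) :
    ∃ D₁ D₂, IsModifiedBesselSolution ν (besselI ν) D₁ D₂ := by
  have hpow : ∀ (a z : ℝ), 0 < z →
      HasDerivAt (fun z : ℝ => (z / 2) ^ a) (a / z * (z / 2) ^ a) z := by
    intro a z hz
    have h := ((hasDerivAt_id z).div_const 2).rpow_const (p := a) (Or.inl (by simp [hz.ne']))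
    refine h.congr_deriv ?_
    simp only [id]
    rw [Real.rpow_sub_one (by positivity)]
    field_simp
  have hent : ∀ (a z : ℝ), HasDerivAt (fun z : ℝ => besselEntire a ((z / 2) ^ 2))
      (besselEntire (a + 1) ((z / 2) ^ 2) * (z / 2)) z := by
    intro a z
    have h : HasDerivAt (fun z : ℝ => (z / 2) ^ 2) (z / 2) z := by
      refine (((hasDerivAt_id z).div_const 2).pow 2).congr_deriv ?_
      simp
      ring
    exact (hasDerivAt_besselEntire a _).comp z h
  refine ⟨fun z => (z / 2) ^ ν * (ν / z * besselEntire ν ((z / 2) ^ 2)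
      + besselEntire (ν + 1) ((z / 2) ^ 2) * (z / 2)), fun z => (z / 2) ^ ν *
      ((ν ^ 2 - ν) / z ^ 2 * besselEntire ν ((z / 2) ^ 2)
      + (ν + 1 / 2) * besselEntire (ν + 1) ((z / 2) ^ 2)
      + (z / 2) ^ 2 * besselEntire (ν + 1 + 1) ((z / 2) ^ 2)), ?_, ?_, ?_⟩
  · intro z hz
    refine (((hpow ν z hz).mul (hent ν z)).congr_of_eventuallyEq ?_).congr_deriv ?_
    · filter_upwards [lt_mem_nhds hz] with v hv using besselI_eq ν hv
    · ring
  · intro z hz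
    have hinv : HasDerivAt (fun z : ℝ => ν / z) (-ν / z ^ 2) z := by
      refine ((hasDerivAt_const z ν).div (hasDerivAt_id z) hz.ne').congr_deriv ?_
      simp
    refine ((hpow ν z hz).mul ((hinv.mul (hent ν z)).add
      ((hent (ν + 1) z).mul ((hasDerivAt_id z).div_const 2)))).congr_deriv ?_
    simp only [id, Pi.mul_apply, Pi.add_apply]
    field_simp
    ring
  · intro z hz
    have hrec := besselEntire_recurrence ν ((z / 2) ^ 2)
    simp only [besselI_eq ν hz]
    rw [← hrec]
    field_simp
    ring

theorem IsModifiedBesselSolution.linear_comb {ν : ℝ} {J D₁ D₂ K E₁ E₂ : ℝ → ℝ}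
    (hJ : IsModifiedBesselSolution ν J D₁ D₂) (hK : IsModifiedBesselSolution ν K E₁ E₂)
    (a b : ℝ) :
    IsModifiedBesselSolution ν (fun z => a * J z + b * K z) (fun z => a * D₁ z + b * E₁ z)
      (fun z => a * D₂ z + b * E₂ z) where
  hasDerivAt z hz := ((hJ.hasDerivAt z hz).const_mul a).add ((hK.hasDerivAt z hz).const_mul b)
  hasDerivAt_deriv z hz :=
    ((hJ.hasDerivAt_deriv z hz).const_mul a).add ((hK.hasDerivAt_deriv z hz).const_mul b)
  equation z hz := by linear_combination a * hJ.equation z hz + b * hK.equation z hz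

/-- First and second derivatives on the half-line of `w · J(m ·)`, where `w` has logarithmic
derivative `g` and `D₁`, `D₂` are the derivatives of `J`. -/
theorem deriv_deriv_mul_comp_const_mul {w g J D₁ D₂ : ℝ → ℝ} {m g' x : ℝ} (hm : 0 < m)
    (hx : 0 < x) (hw : ∀ ξ > 0, HasDerivAt w (w ξ * g ξ) ξ) (hg : HasDerivAt g g' x)
    (hJ : ∀ z > 0, HasDerivAt J (D₁ z) z) (hD : ∀ z > 0, HasDerivAt D₁ (D₂ z) z) :
    deriv (fun ξ => w ξ * J (m * ξ)) x = w x * (g x * J (m * x) + m * D₁ (m * x)) ∧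
    deriv (deriv fun ξ => w ξ * J (m * ξ)) x
      = w x * ((g x ^ 2 + g') * J (m * x) + 2 * g x * m * D₁ (m * x)
        + m ^ 2 * D₂ (m * x)) := by
  have hlin : ∀ ξ, HasDerivAt (fun ξ => m * ξ) m ξ := fun ξ => by
    simpa using (hasDerivAt_id ξ).const_mul m
  have hJm : ∀ ξ > 0, HasDerivAt (fun ξ => J (m * ξ)) (D₁ (m * ξ) * m) ξ := fun ξ hξ =>
    (hJ _ (mul_pos hm hξ)).comp ξ (hlin ξ)
  have hDm : HasDerivAt (fun ξ => D₁ (m * ξ)) (D₂ (m * x) * m) x :=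
    (hD _ (mul_pos hm hx)).comp x (hlin x)
  have hfirst : ∀ ξ > 0, deriv (fun ξ => w ξ * J (m * ξ)) ξ
      = w ξ * (g ξ * J (m * ξ) + m * D₁ (m * ξ)) := by
    intro ξ hξ
    rw [((hw ξ hξ).fun_mul (hJm ξ hξ)).deriv]
    ring
  refine ⟨hfirst x hx, ?_⟩
  have heq : deriv (fun ξ => w ξ * J (m * ξ)) =ᶠ[nhds x]
      fun ξ => w ξ * (g ξ * J (m * ξ) + m * D₁ (m * ξ)) := by
    filter_upwards [lt_mem_nhds hx] with ξ hξ using hfirst ξ hξ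
  rw [heq.deriv_eq, ((hw x hx).fun_mul ((hg.fun_mul (hJm x hx)).fun_add
    (hDm.const_mul m))).deriv]
  ring

/-- The fundamental solution formula of Theorem 5.11 for the PDE
`u_t = σ u_xx + f(x) u_x - μ x² u` (the `γ = 0` case) when the drift `f` solves the
Riccati equation `σ f' + f²/2 = C/x² + B/2 + (1/8)(A - 16μσ)x²` with `A > 0`. -/
theorem stmt_19 (σ μ A B C β : ℝ) (hσ : 0 < σ) (hμ : 0 ≤ μ) (hA : 0 < A)
    (hC : 0 < 1 + 2 * C / σ ^ 2)
    (hβ : β = (1 / 2) * Real.sqrt (1 + 2 * C / σ ^ 2)) (hβint : ∀ n : ℤ, β ≠ (n : ℝ))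
    (f F : ℝ → ℝ)
    (hf : ∀ x > (0 : ℝ), DifferentiableAt ℝ f x)
    (hRic : ∀ x > (0 : ℝ),
      σ * deriv f x + (1 / 2) * (f x) ^ 2
        = C / x ^ 2 + B / 2 + (1 / 8) * (A - 16 * μ * σ) * x ^ 2)
    (hF : ∀ x > (0 : ℝ), HasDerivAt F (f x) x)
    (y : ℝ) (hy : 0 < y) (C₁ C₂ : ℝ)
    (p : ℝ → ℝ → ℝ)
    (hp : ∀ t x, p t x =
      (Real.sqrt (A * x * y) / (2 * Real.sinh (Real.sqrt A * t / 2)))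
        * Real.exp (-B * t / (4 * σ) + (F y - F x) / (2 * σ)
            - Real.sqrt A * (x ^ 2 + y ^ 2)
                / (8 * σ * Real.tanh (Real.sqrt A * t / 2)))
        * (C₁ * besselI β
              (Real.sqrt A * x * y / (4 * σ * Real.sinh (Real.sqrt A * t / 2)))
          + C₂ * besselI (-β)
              (Real.sqrt A * x * y / (4 * σ * Real.sinh (Real.sqrt A * t / 2)))) ) :
    ∀ t > (0 : ℝ), ∀ x > (0 : ℝ),
      deriv (fun τ => p τ x) t
        = σ * deriv (deriv (fun ξ => p t ξ)) x
          + f x * deriv (fun ξ => p t ξ) x - μ * x ^ 2 * p t x := by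
  intro t ht x hx
  obtain ⟨D₁, D₂, J, hJ, hJdef⟩ : ∃ D₁ D₂ J, IsModifiedBesselSolution β J D₁ D₂ ∧
      ∀ z, C₁ * besselI β z + C₂ * besselI (-β) z = J z := by
    obtain ⟨D₁, D₂, hD⟩ := exists_isModifiedBesselSolution_besselI β
    obtain ⟨E₁, E₂, hE⟩ := exists_isModifiedBesselSolution_besselI (-β)
    have hE' : IsModifiedBesselSolution β (besselI (-β)) E₁ E₂ :=
      ⟨hE.hasDerivAt, hE.hasDerivAt_deriv, fun z hz => by simpa using hE.equation z hz⟩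
    exact ⟨_, _, _, hD.linear_comb hE' C₁ C₂, fun z => rfl⟩
  simp only [hJdef, Real.tanh_eq_sinh_div_cosh] at hp
  obtain ⟨s, hs0, hsA⟩ : ∃ s, 0 < s ∧ s = √A := ⟨_, Real.sqrt_pos.mpr hA, rfl⟩
  have hs2 : s ^ 2 = A := by rw [hsA, Real.sq_sqrt hA.le]
  rw [← hsA] at hp
  have hβ2 : β ^ 2 = (1 + 2 * C / σ ^ 2) / 4 := by
    rw [hβ, mul_pow, Real.sq_sqrt hC.le]
    ring
  have hS : 0 < sinh (s * t / 2) := Real.sinh_pos_iff.mpr (by positivity)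
  have hcs := Real.cosh_sq (s * t / 2)
  have hm : 0 < s * y / (4 * σ * sinh (s * t / 2)) := by positivity
  set m := s * y / (4 * σ * sinh (s * t / 2)) with hmdef
  -- the amplitude in front of the Bessel factor
  let w : ℝ → ℝ → ℝ := fun τ ξ => √(A * ξ * y) / (2 * sinh (s * τ / 2)) *
    exp (-B * τ / (4 * σ) + (F y - F ξ) / (2 * σ)
      - s * (ξ ^ 2 + y ^ 2) / (8 * σ * (sinh (s * τ / 2) / cosh (s * τ / 2))))
  have hpx : (fun ξ => p t ξ) = fun ξ => w t ξ * J (m * ξ) := by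
    funext ξ
    rw [hp t ξ, hmdef]
    congr 2
    ring
  let g : ℝ → ℝ := fun ξ => 1 / (2 * ξ) - f ξ / (2 * σ)
    - s * ξ * cosh (s * t / 2) / (4 * σ * sinh (s * t / 2))
  have hw : ∀ ξ > 0, HasDerivAt (w t) (w t ξ * g ξ) ξ := by
    intro ξ hξ
    have hpos : 0 < A * ξ * y := by positivity
    have hsqrt : HasDerivAt (fun ξ => √(A * ξ * y)) (√(A * ξ * y) / (2 * ξ)) ξ := by
      have h0 : HasDerivAt (fun ξ => A * ξ * y) (A * y) ξ := by
        simpa using ((hasDerivAt_id ξ).const_mul A).mul_const y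
      refine (h0.sqrt hpos.ne').congr_deriv ?_
      have := Real.sqrt_pos.mpr hpos
      rw [div_eq_div_iff (by positivity) (by positivity)]
      linear_combination -2 * Real.sq_sqrt hpos.le
    have hexp := (((((hF ξ hξ).const_sub (F y)).div_const (2 * σ)).const_add
      (-B * t / (4 * σ))).sub ((((hasDerivAt_pow 2 ξ).add_const (y ^ 2)).const_mul s).div_const
      (8 * σ * (sinh (s * t / 2) / cosh (s * t / 2))))).exp
    refine ((hsqrt.div_const (2 * sinh (s * t / 2))).mul hexp).congr_deriv ?_
    have hco := (Real.cosh_pos (s * t / 2)).ne'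
    simp only [w, g, Pi.sub_apply]
    field_simp
    ring
  have hg : HasDerivAt g (-1 / (2 * x ^ 2) - deriv f x / (2 * σ)
      - s * cosh (s * t / 2) / (4 * σ * sinh (s * t / 2))) x := by
    have h1 : HasDerivAt (fun ξ : ℝ => 1 / (2 * ξ)) (-1 / (2 * x ^ 2)) x := by
      refine ((hasDerivAt_const x (1 : ℝ)).div ((hasDerivAt_id x).const_mul 2)
        (by simpa using hx.ne')).congr_deriv ?_
      simp only [id]
      field_simp
      ring
    refine ((h1.sub ((hf x hx).hasDerivAt.div_const (2 * σ))).sub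
      ((((hasDerivAt_id x).const_mul s).mul_const (cosh (s * t / 2))).div_const
        (4 * σ * sinh (s * t / 2)))).congr_deriv ?_
    ring
  obtain ⟨hd1, hd2⟩ := deriv_deriv_mul_comp_const_mul hm hx hw hg hJ.hasDerivAt
    hJ.hasDerivAt_deriv
  have hmx : s * x * y / (4 * σ * sinh (s * t / 2)) = m * x := by rw [hmdef]; ring
  have htime : HasDerivAt (fun τ => p τ x) (w t x *
      ((-(s / 2) * cosh (s * t / 2) / sinh (s * t / 2) - B / (4 * σ)
        + s ^ 2 * (x ^ 2 + y ^ 2) / (16 * σ * sinh (s * t / 2) ^ 2)) * J (m * x)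
        - m * x * (s / 2) * cosh (s * t / 2) / sinh (s * t / 2) * D₁ (m * x))) t := by
    have hlin : HasDerivAt (fun τ => s * τ / 2) (s / 2) t := by
      simpa using ((hasDerivAt_id t).const_mul s).div_const 2
    have hsinh := hlin.sinh
    have hcosh := hlin.cosh
    have hco := (Real.cosh_pos (s * t / 2)).ne'
    have hz : HasDerivAt (fun τ => s * x * y / (4 * σ * sinh (s * τ / 2)))
        (-(m * x * (s / 2) * cosh (s * t / 2) / sinh (s * t / 2))) t := by
      refine ((hasDerivAt_const t (s * x * y)).div (hsinh.const_mul (4 * σ))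
        (by positivity)).congr_deriv ?_
      rw [hmdef]
      field_simp
      ring
    have hJt : HasDerivAt (fun τ => J (s * x * y / (4 * σ * sinh (s * τ / 2)))) _ t :=
      HasDerivAt.comp t (hmx ▸ hJ.hasDerivAt (m * x) (mul_pos hm hx)) hz
    have hamp := (hasDerivAt_const t (√(A * x * y))).div (hsinh.const_mul 2) (by positivity)
    have hcoth : HasDerivAt (fun τ => s * (x ^ 2 + y ^ 2)
        / (8 * σ * (sinh (s * τ / 2) / cosh (s * τ / 2))))
        (-(s ^ 2 * (x ^ 2 + y ^ 2) / (16 * σ * sinh (s * t / 2) ^ 2))) t := by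
      refine ((hasDerivAt_const t (s * (x ^ 2 + y ^ 2))).div
        ((hsinh.div hcosh hco).const_mul (8 * σ)) (mul_pos (by positivity)
          (div_pos hS (Real.cosh_pos _))).ne').congr_deriv ?_
      simp only [Pi.div_apply]
      field_simp
      rw [hcs]
      ring
    have hlint : HasDerivAt (fun τ => -B * τ / (4 * σ) + (F y - F x) / (2 * σ))
        (-B / (4 * σ)) t := by
      simpa using (((hasDerivAt_id t).const_mul (-B)).div_const (4 * σ)).add_const
        ((F y - F x) / (2 * σ))
    refine (((hamp.mul (hlint.sub hcoth).exp).mul hJt).congr_of_eventuallyEq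
      (Filter.Eventually.of_forall fun τ => hp τ x)).congr_deriv ?_
    simp only [w, Pi.mul_apply, Pi.sub_apply, Pi.div_apply, hmx]
    field_simp
    ring
  have hpt : p t x = w t x * J (m * x) := congrFun hpx x
  rw [htime.deriv, hpx, hd1, hd2, hpt]
  have hode := hJ.equation (m * x) (mul_pos hm hx)
  have hD2 : m ^ 2 * D₂ (m * x)
      = ((m ^ 2 + β ^ 2 / x ^ 2) * J (m * x) - m / x * D₁ (m * x)) := by
    field_simp
    linear_combination hode
  have hR : deriv f x = (C / x ^ 2 + B / 2 + (1 / 8) * (A - 16 * μ * σ) * x ^ 2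
      - (1 / 2) * (f x) ^ 2) / σ := by
    rw [← hRic x hx]
    field_simp
    ring
  rw [hD2, hR, hβ2]
  have hmsq : m ^ 2 = s ^ 2 * y ^ 2 / (16 * σ ^ 2 * sinh (s * t / 2) ^ 2) := by
    rw [hmdef]; ring
  rw [hmsq, ← hs2]
  simp only [g]
  linear_combination (norm := skip)
    (-(w t x * J (m * x) * s ^ 2 * x ^ 2 / (16 * σ * sinh (s * t / 2) ^ 2))) * hcs
  generalize w t x = W, J (m * x) = j, D₁ (m * x) = d, sinh (s * t / 2) = S,
    cosh (s * t / 2) = c, f x = φ at hS ⊢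
  clear_value m
  field_simp
  ring
end
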